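/- arXiv:2505.08015 — 2 statements merged into one kernel-verified Lean document; each statement's English description precedes it below -/
import Mathlib

section
/- Let n > 4 be an even integer, let A_1, …, A_n be points in ℝ² lying on a circle in anticlockwise order with circumradius R, and for 1 ≤ m ≤ n set δ(m) := ∏_{i=1, i≠m}^{n−1} ∏_{j=i+1, j≠m}^{n} δ_{ij}. Then for every odd m with 3 < m ≤ n−1: δ(m) = (S_{1,2,m−1}·S_{1,2,m+1}·R² / x_{12}) · (∏_{l even, 2 ≤ l ≤ m−2} S_{1,l,l+1}·R) · (∏_{l odd, m+2 ≤ l ≤ n−1} S_{1,l,l+1}·R) · (∏_{l odd, m+2 ≤ l ≤ n−1} (S_{m−1,l,l+1}·S_{m−3,l,l+1}·R² / x_{l,l+1})) · (∏_{k odd, 3 ≤ k ≤ m−4} ((S_{k,k+1,m−1}·S_{k,k+1,m+1}·R² / x_{k,k+1}) · ∏_{l even, k+1 ≤ l ≤ m−2} (S_{k,l,l+1}·R / x_{l,l+1}) · ∏_{l odd, m+2 ≤ l ≤ n−1} (1 / x_{l,l+1}))) · (∏_{k even, 2 ≤ k ≤ m−5} ∏_{l even, k+2 ≤ l ≤ m−2}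 S_{k,l,l+1}·R) · (∏_{k=2}^{m−4} ∏_{l odd, m+2 ≤ l ≤ n−1} S_{k,l,l+1}·R) · S_{m−2,m−1,m+1}·R · (∏_{l odd, m+2 ≤ l ≤ n−1} (S_{m−2,l,l+1}·R / x_{l,l+1})) · (∏_{k odd, m ≤ k ≤ n−3} S_{k+1,k+2,k+3}·R) · (∏_{k=m}^{n−3} ∏_{l odd, k+3 ≤ l ≤ n−1} S_{k+1,l,l+1}·R) · (∏_{k odd, m ≤ k ≤ n−3} ∏_{l odd, k+3 ≤ l ≤ n−1} (1 / x_{l,l+1})). -/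
open Finset

/-- Squared distance between two points of `ℝ × ℝ`. -/
noncomputable def sqDist (P Q : ℝ × ℝ) : ℝ := (Q.1 - P.1)^2 + (Q.2 - P.2)^2

/-- Distance between two points of `ℝ × ℝ`. -/
noncomputable def pdist (P Q : ℝ × ℝ) : ℝ := Real.sqrt (sqDist P Q)

/-- Four times the signed area of the triangle `P Q T`. -/
noncomputable def S4 (P Q T : ℝ × ℝ) : ℝ :=
  2 * ((Q.1 - P.1) * (T.2 - P.2) - (Q.2 - P.2) * (T.1 - P.1))

/-- The product of all pairwise distances among the vertices `A_1,…,A_n` other than `A_m`. -/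
noncomputable def deltaProd (A : ℤ → ℝ × ℝ) (n m : ℤ) : ℝ :=
  ∏ i ∈ (Finset.Icc 1 (n-1)).filter (fun i => i ≠ m),
    ∏ j ∈ (Finset.Icc (i+1) n).filter (fun j => j ≠ m), pdist (A i) (A j)

/-! ### Helpers -/

theorem h_theta (n : ℤ) (θ : ℤ → ℝ)
    (hmono : ∀ i, 1 ≤ i → i < n → θ i < θ (i + 1)) (i : ℤ) (hi : 1 ≤ i) (k : ℕ) :
    i + k + 1 ≤ n → θ i < θ (i + k + 1) := by
  induction k with
  | zero => intro h; simpa using hmono i hi (by push_cast at h; omega)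
  | succ k ih =>
    intro h
    push_cast at h ⊢
    have h1 := ih (by omega)
    have h2 := hmono (i + k + 1) (by omega) (by omega)
    rw [show i + ((k:ℤ) + 1) + 1 = i + k + 1 + 1 by ring]
    linarith

theorem h_theta' (n : ℤ) (θ : ℤ → ℝ)
    (hmono : ∀ i, 1 ≤ i → i < n → θ i < θ (i + 1)) (i j : ℤ) (hi : 1 ≤ i) (hij : i < j)
    (hj : j ≤ n) : θ i < θ j := by
  have h := h_theta n θ hmono i hi (j - i - 1).toNat
  have e : (((j - i - 1).toNat : ℕ) : ℤ) = j - i - 1 := Int.toNat_of_nonneg (by omega)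
  rw [e] at h
  rw [show i + (j - i - 1) + 1 = j by ring] at h
  exact h hj

theorem h_sq (O : ℝ × ℝ) (R a b : ℝ) :
    sqDist (O.1 + R * Real.cos a, O.2 + R * Real.sin a) (O.1 + R * Real.cos b, O.2 + R * Real.sin b)
      = (2 * R * Real.sin ((b - a) / 2)) ^ 2 := by
  have ha : a = (a + b) / 2 - (b - a) / 2 := by ring
  have hb : b = (a + b) / 2 + (b - a) / 2 := by ring
  simp only [sqDist]
  generalize hu : (a + b) / 2 = u at *
  generalize hv : (b - a) / 2 = v at *
  rw [ha, hb, Real.cos_sub, Real.cos_add, Real.sin_sub, Real.sin_add]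
  linear_combination (4 * R ^ 2 * Real.sin v ^ 2) * Real.sin_sq_add_cos_sq u

theorem h_S (O : ℝ × ℝ) (R a b c : ℝ) :
    S4 (O.1 + R * Real.cos a, O.2 + R * Real.sin a) (O.1 + R * Real.cos b, O.2 + R * Real.sin b)
      (O.1 + R * Real.cos c, O.2 + R * Real.sin c) * R
      = (2 * R * Real.sin ((b - a) / 2)) * (2 * R * Real.sin ((c - b) / 2)) *
        (2 * R * Real.sin ((c - a) / 2)) := by
  have hx : (c - a) / 2 = (b - a) / 2 + (c - b) / 2 := by ring
  have ha : a = b - 2 * ((b - a) / 2) := by ring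
  have hc : c = b + 2 * ((c - b) / 2) := by ring
  simp only [S4]
  rw [hx]
  generalize hu : (b - a) / 2 = u at *
  generalize hv : (c - b) / 2 = v at *
  rw [ha, hc, Real.cos_sub, Real.cos_add, Real.sin_sub, Real.sin_add, Real.sin_add,
    Real.sin_two_mul, Real.sin_two_mul, Real.cos_two_mul', Real.cos_two_mul']
  have h1 := Real.sin_sq_add_cos_sq b
  have h2 := Real.sin_sq_add_cos_sq u
  have h3 := Real.sin_sq_add_cos_sq v
  generalize Real.sin b = sb at *
  generalize Real.cos b = cb at *
  generalize Real.sin u = su at *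
  generalize Real.cos u = cu at *
  generalize Real.sin v = sv at *
  generalize Real.cos v = cv at *
  have e1 : cb ^ 2 = 1 - sb ^ 2 := by linarith
  have e2 : cu ^ 2 = 1 - su ^ 2 := by linarith
  have e3 : cv ^ 2 = 1 - sv ^ 2 := by linarith
  rw [e2, e3]
  ring_nf
  rw [e1]
  ring_nf

theorem h_icc {M : Type*} [CommMonoid M] (g : ℤ → M) (p q : ℤ) (N : ℕ) (hq : q = p + N - 1) :
    ∏ l ∈ Finset.Icc p q, g l = ∏ i ∈ range N, g (p + i) := by
  subst hq
  symm
  apply Finset.prod_bij (fun (i : ℕ) _ => p + (i : ℤ))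
  · intro i hi; simp at hi ⊢; omega
  · intro i _ j _ h; simpa using h
  · intro l hl
    simp at hl
    exact ⟨(l - p).toNat, by simp; omega, by simp; omega⟩
  · intros; rfl

theorem h_even {M : Type*} [CommMonoid M] (g : ℤ → M) (p q r : ℤ) (N : ℕ) (hr : Even r)
    (h1 : p ≤ r) (h2 : r ≤ p + 1) (h3 : q < r + 2 * N) (h4 : 0 < N → r + 2 * N - 2 ≤ q) :
    ∏ l ∈ (Finset.Icc p q).filter (fun l => Even l), g l = ∏ i ∈ range N, g (r + 2 * i) := by
  symm
  rw [Int.even_iff] at hr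
  apply Finset.prod_bij (fun (i : ℕ) _ => r + 2 * (i : ℤ))
  · intro i hi; simp [Int.even_iff] at hi ⊢; omega
  · intro i _ j _ h; simpa using h
  · intro l hl
    simp [Int.even_iff] at hl
    exact ⟨((l - r) / 2).toNat, by simp; omega, by simp; omega⟩
  · intros; rfl

theorem h_odd {M : Type*} [CommMonoid M] (g : ℤ → M) (p q r : ℤ) (N : ℕ) (hr : Odd r)
    (h1 : p ≤ r) (h2 : r ≤ p + 1) (h3 : q < r + 2 * N) (h4 : 0 < N → r + 2 * N - 2 ≤ q) :
    ∏ l ∈ (Finset.Icc p q).filter (fun l => Odd l), g l = ∏ i ∈ range N, g (r + 2 * i) := by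
  symm
  rw [Int.odd_iff] at hr
  apply Finset.prod_bij (fun (i : ℕ) _ => r + 2 * (i : ℤ))
  · intro i hi; simp [Int.odd_iff] at hi ⊢; omega
  · intro i _ j _ h; simpa using h
  · intro l hl
    simp [Int.odd_iff] at hl
    exact ⟨((l - r) / 2).toNat, by simp; omega, by simp; omega⟩
  · intros; rfl

theorem h_exp (N : ℕ) (F G : ℕ → ℝ) (h : ∀ i < N, F i = Real.exp (G i)) :
    ∏ i ∈ range N, F i = Real.exp (∑ i ∈ range N, G i) := by
  rw [Real.exp_sum]
  exact Finset.prod_congr rfl (fun i hi => h i (by simpa using hi))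

theorem h_ne {M : Type*} [CommMonoid M] (g : ℤ → M) (p q m : ℤ) (h : p ≤ m) (h' : m ≤ q) :
    ∏ l ∈ (Finset.Icc p q).filter (fun l => l ≠ m), g l
      = (∏ l ∈ Finset.Icc p (m-1), g l) * ∏ l ∈ Finset.Icc (m+1) q, g l := by
  rw [← Finset.prod_union]
  · congr 1
    ext x; simp; omega
  · rw [Finset.disjoint_left]; intro x; simp; omega

theorem h_ne' {M : Type*} [CommMonoid M] (g : ℤ → M) (p q m : ℤ) (h : q < m) :
    ∏ l ∈ (Finset.Icc p q).filter (fun l => l ≠ m), g l = ∏ l ∈ Finset.Icc p q, g l := by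
  congr 1
  ext x; simp; omega

theorem h_delta (d : ℤ → ℤ → ℝ) (n m : ℤ) :
    ∏ i ∈ (Finset.Icc 1 (n-1)).filter (fun i => i ≠ m),
      ∏ j ∈ (Finset.Icc (i+1) n).filter (fun j => j ≠ m), d i j
    = ∏ j ∈ (Finset.Icc 1 n).filter (fun j => j ≠ m),
      ∏ i ∈ (Finset.Icc 1 (j-1)).filter (fun i => i ≠ m), d i j := by
  apply Finset.prod_comm'
  intro x y; simp; omega

theorem h_tri (g : ℕ → ℕ → ℝ) (a : ℕ) :
    ∑ i ∈ range (a+1), ∑ j ∈ range (a + 1 - i), g i (i + j)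
      = ∑ i ∈ range a, ∑ j ∈ range (a - i), g i (i + j) + ∑ i ∈ range (a+1), g i a := by
  rw [Finset.sum_range_succ, Finset.sum_range_succ (fun i => g i a), ← add_assoc,
    ← Finset.sum_add_distrib]
  congr 1
  · apply Finset.sum_congr rfl
    intro i hi
    simp at hi
    rw [show a + 1 - i = (a - i) + 1 by omega, Finset.sum_range_succ,
      show i + (a - i) = a by omega]
  · simp

theorem h_tri' (g : ℕ → ℕ → ℝ) (a : ℕ) :
    ∑ i ∈ range (a+1), ∑ j ∈ range (a + 1 - 1 - i), g i (i + j + 1)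
      = ∑ i ∈ range a, ∑ j ∈ range (a - 1 - i), g i (i + j + 1) + ∑ i ∈ range a, g i a := by
  rw [Finset.sum_range_succ, ← Finset.sum_add_distrib]
  simp only [Nat.add_sub_cancel, Nat.sub_self, Finset.range_zero, Finset.sum_empty, add_zero]
  apply Finset.sum_congr rfl
  intro i hi
  simp at hi
  rw [show a - i = (a - 1 - i) + 1 by omega, Finset.sum_range_succ,
      show i + (a - 1 - i) + 1 = a by omega]

theorem h_two (g : ℕ → ℝ) (b : ℕ) :
    ∑ i ∈ range (2 * b), g i = ∑ i ∈ range b, (g (2 * i) + g (2 * i + 1)) := by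
  induction b with
  | zero => simp
  | succ b ih =>
    rw [show 2 * (b + 1) = 2 * b + 1 + 1 by ring, Finset.sum_range_succ, Finset.sum_range_succ, ih,
      Finset.sum_range_succ]; ring

/-- the exponent of `S4 * R` -/
def tt (f : ℤ → ℤ → ℝ) (i j k : ℤ) : ℝ := f i j + f j k + f i k

/-- points `1..2a+3` -/
theorem core0 (f : ℤ → ℤ → ℝ) (a : ℕ) :
    ∑ t ∈ range (2 * a + 3), ∑ i ∈ range t, f (1 + i) (1 + t)
    = ∑ i ∈ range (a + 1), tt f 1 (2 + 2 * i) (2 + 2 * i + 1)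
      + ∑ i ∈ range a, ∑ j ∈ range (a - i),
          (tt f (3 + 2 * i) (4 + 2 * (i + j : ℕ)) (4 + 2 * (i + j : ℕ) + 1)
            - 2 * f (4 + 2 * (i + j : ℕ)) (4 + 2 * (i + j : ℕ) + 1))
      + ∑ i ∈ range a, ∑ j ∈ range (a - i),
          tt f (2 + 2 * i) (4 + 2 * (i + j : ℕ)) (4 + 2 * (i + j : ℕ) + 1) := by
  induction a with
  | zero => simp [tt, Finset.sum_range_succ]; ring
  | succ a ih =>
    rw [show 2 * (a + 1) + 3 = 2 * a + 3 + 1 + 1 by ring, Finset.sum_range_succ,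
      Finset.sum_range_succ, ih, Finset.sum_range_succ _ (a + 1),
      h_tri (fun i l => tt f (3 + 2 * (i:ℤ)) (4 + 2 * (l : ℕ)) (4 + 2 * (l : ℕ) + 1)
            - 2 * f (4 + 2 * (l : ℕ)) (4 + 2 * (l : ℕ) + 1)) a,
      h_tri (fun i l => tt f (2 + 2 * (i:ℤ)) (4 + 2 * (l : ℕ)) (4 + 2 * (l : ℕ) + 1)) a]
    have key : ∀ x : ℤ, ∑ i ∈ range (2 * a + 3), f (1 + (i:ℤ)) x = f 1 x
        + ∑ i ∈ range (a + 1), f (2 + 2 * (i:ℤ)) x + ∑ i ∈ range (a + 1), f (3 + 2 * (i:ℤ)) x := by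
      intro x
      rw [show 2 * a + 3 = 2 * (a + 1) + 1 by ring, Finset.sum_range_succ', h_two, add_comm,
        add_assoc, ← Finset.sum_add_distrib]
      congr 1
      apply Finset.sum_congr rfl
      intro i _
      push_cast
      congr 2 <;> ring
    rw [Finset.sum_range_succ _ (2 * a + 3), key, key]
    have e1 : (1 + ((2 * a + 3 : ℕ) : ℤ)) = 4 + 2 * (a : ℤ) := by push_cast; ring
    have e2 : (1 + ((2 * a + 3 + 1 : ℕ) : ℤ)) = 4 + 2 * (a : ℤ) + 1 := by push_cast; ring
    have e3 : (2 + 2 * ((a + 1 : ℕ) : ℤ)) = 4 + 2 * (a : ℤ) := by push_cast; ring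
    rw [e1, e2, e3]
    simp only [tt, Finset.sum_add_distrib, Finset.sum_sub_distrib, Finset.sum_const,
      Finset.card_range, nsmul_eq_mul]
    push_cast
    ring

/-- a full column `x` over points `1..2a+4` -/
theorem core_col (f : ℤ → ℤ → ℝ) (a : ℕ) (x : ℤ) :
    ∑ i ∈ range (2 * a + 3), f (1 + (i:ℤ)) x = f 1 x + f 2 x
      + ∑ i ∈ range a, (f (3 + 2 * (i:ℤ)) x + f (3 + 2 * (i:ℤ) + 1) x) + f (2 * a + 3) x := by
  rw [Finset.sum_range_succ, Finset.sum_range_succ', Finset.sum_range_succ', h_two]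
  have : ∀ i : ℕ, f (1 + ((2 * i + 1 + 1 : ℕ) : ℤ)) x + f (1 + ((2 * i + 1 + 1 + 1 : ℕ) : ℤ)) x
    = f (3 + 2 * (i:ℤ)) x + f (3 + 2 * (i:ℤ) + 1) x := by
    intro i; push_cast; congr 2 <;> ring
  simp only [this]
  push_cast
  rw [show (1 + (2 * (a:ℤ) + 2)) = 2 * a + 3 by ring]
  norm_num
  ring

theorem core1 (f : ℤ → ℤ → ℝ) (a : ℕ) (m : ℤ) (hm : m = 2 * a + 5) :
    ∑ t ∈ range (2 * a + 4), ∑ i ∈ range t, f (1 + i) (1 + t)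
      + ∑ i ∈ range (2 * a + 4), f (1 + i) (m + 1)
    = (tt f 1 2 (m-1) + tt f 1 2 (m+1) - 2 * f 1 2)
      + ∑ i ∈ range (a + 1), tt f 1 (2 + 2 * i) (2 + 2 * i + 1)
      + ∑ i ∈ range a, ((tt f (3 + 2 * i) (3 + 2 * i + 1) (m - 1)
          + tt f (3 + 2 * i) (3 + 2 * i + 1) (m + 1) - 2 * f (3 + 2 * i) (3 + 2 * i + 1))
          + ∑ j ∈ range (a - i),
          (tt f (3 + 2 * i) (4 + 2 * (i + j : ℕ)) (4 + 2 * (i + j : ℕ) + 1)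
            - 2 * f (4 + 2 * (i + j : ℕ)) (4 + 2 * (i + j : ℕ) + 1)))
      + ∑ i ∈ range a, ∑ j ∈ range (a - i),
          tt f (2 + 2 * i) (4 + 2 * (i + j : ℕ)) (4 + 2 * (i + j : ℕ) + 1)
      + tt f (m - 2) (m - 1) (m + 1) := by
  rw [Finset.sum_range_succ _ (2 * a + 3), Finset.sum_range_succ _ (2 * a + 3), core0, core_col,
    core_col]
  have e1 : (1 + ((2 * a + 3 : ℕ) : ℤ)) = m - 1 := by push_cast; rw [hm]; ring
  have e2 : 2 * (a : ℤ) + 3 = m - 2 := by rw [hm]; ring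
  rw [e1, e2, Finset.sum_add_distrib (s := range a) (g := fun i => ∑ j ∈ range (a - i), _)]
  have e3 : ∀ i : ℕ, (tt f (3 + 2 * i) (3 + 2 * i + 1) (m - 1)
          + tt f (3 + 2 * i) (3 + 2 * i + 1) (m + 1) - 2 * f (3 + 2 * i) (3 + 2 * i + 1))
     = (f (3 + 2 * (i:ℤ)) (m-1) + f (3 + 2 * (i:ℤ) + 1) (m-1)) +
     (f (3 + 2 * (i:ℤ)) (m+1) + f (3 + 2 * (i:ℤ) + 1) (m+1)) := by
    intro i; simp only [tt]; ring
  simp only [e3]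
  rw [Finset.sum_add_distrib (s := range a) (f := fun i : ℕ =>
    (f (3 + 2 * (i:ℤ)) (m-1) + f (3 + 2 * (i:ℤ) + 1) (m-1)))]
  simp only [tt]
  ring

theorem core2 (f : ℤ → ℤ → ℝ) (a b : ℕ) (m : ℤ) (hm : m = 2 * a + 5) :
    ∑ t ∈ range (2 * b), (∑ i ∈ range (2 * a + 4), f (1 + i) (m + 2 + t)
      + ∑ i ∈ range (t + 1), f (m + 1 + i) (m + 2 + t))
    = ∑ i ∈ range b, tt f 1 (m + 2 + 2 * i) (m + 2 + 2 * i + 1)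
      + ∑ i ∈ range b, (tt f (m-1) (m + 2 + 2 * i) (m + 2 + 2 * i + 1)
          + tt f (m-3) (m + 2 + 2 * i) (m + 2 + 2 * i + 1)
          - 2 * f (m + 2 + 2 * i) (m + 2 + 2 * i + 1))
      + ∑ _k ∈ range a, ∑ i ∈ range b, (- (2 * f (m + 2 + 2 * i) (m + 2 + 2 * i + 1)))
      + ∑ k ∈ range (2 * a), ∑ i ∈ range b, tt f (2 + k) (m + 2 + 2 * i) (m + 2 + 2 * i + 1)
      + ∑ i ∈ range b, (tt f (m-2) (m + 2 + 2 * i) (m + 2 + 2 * i + 1)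
          - 2 * f (m + 2 + 2 * i) (m + 2 + 2 * i + 1))
      + ∑ i ∈ range b, tt f (m + 2 * i + 1) (m + 2 * i + 2) (m + 2 * i + 3)
      + (∑ i ∈ range b, ∑ j ∈ range (b - 1 - i),
          tt f (m + 2 * i + 1) (m + 2 + 2 * (i + j + 1 : ℕ)) (m + 2 + 2 * (i + j + 1 : ℕ) + 1)
        + ∑ i ∈ range b, ∑ j ∈ range (b - 1 - i),
          tt f (m + 1 + 2 * i + 1) (m + 2 + 2 * (i + j + 1 : ℕ)) (m + 2 + 2 * (i + j + 1 : ℕ) + 1))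
      + ∑ i ∈ range b, ∑ j ∈ range (b - 1 - i),
          (- (2 * f (m + 2 + 2 * (i + j + 1 : ℕ)) (m + 2 + 2 * (i + j + 1 : ℕ) + 1))) := by
  induction b with
  | zero => simp
  | succ b ih =>
    rw [show 2 * (b + 1) = 2 * b + 1 + 1 by ring, Finset.sum_range_succ, Finset.sum_range_succ, ih,
      h_tri' (fun i l => tt f (m + 2 * i + 1) (m + 2 + 2 * (l : ℕ)) (m + 2 + 2 * (l : ℕ) + 1)) b,
      h_tri' (fun i l => tt f (m + 1 + 2 * i + 1) (m + 2 + 2 * (l : ℕ)) (m + 2 + 2 * (l : ℕ) + 1)) b,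
      h_tri' (fun i l => (- (2 * f (m + 2 + 2 * (l : ℕ)) (m + 2 + 2 * (l : ℕ) + 1)))) b]
    simp only [Finset.sum_range_succ _ b, Finset.sum_add_distrib (s := range (2 * a)),
      Finset.sum_add_distrib (s := range a)]
    have key : ∀ x : ℤ, ∑ i ∈ range (2 * a + 4), f (1 + (i:ℤ)) x = f 1 x
        + ∑ i ∈ range (2 * a), f (2 + (i:ℤ)) x + f (m - 3) x + f (m - 2) x + f (m - 1) x := by
      intro x
      rw [Finset.sum_range_succ', Finset.sum_range_succ, Finset.sum_range_succ,
        Finset.sum_range_succ]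
      have : ∀ i : ℕ, f (1 + ((i + 1 : ℕ) : ℤ)) x = f (2 + (i:ℤ)) x := by
        intro i; congr 1; push_cast; ring
      simp only [this]
      push_cast
      rw [show 2 + 2 * (a:ℤ) = m - 3 by rw [hm]; ring,
        show 2 + (2 * (a:ℤ) + 1) = m - 2 by rw [hm]; ring,
        show 2 + (2 * (a:ℤ) + 2) = m - 1 by rw [hm]; ring]
      ring
    have key2 : ∀ x : ℤ, ∑ i ∈ range (2 * b + 1), f (m + 1 + (i:ℤ)) x =
        ∑ i ∈ range b, f (m + 2 * i + 1) x + ∑ i ∈ range b, f (m + 1 + 2 * i + 1) x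
          + f (m + 2 * b + 1) x := by
      intro x
      rw [Finset.sum_range_succ, h_two, ← Finset.sum_add_distrib]
      congr 1
      · apply Finset.sum_congr rfl
        intro i _
        push_cast
        congr 2 <;> ring
      · congr 1; push_cast; ring
    rw [Finset.sum_range_succ _ (2 * b + 1), key, key, key2, key2]
    have e1 : m + 2 + ((2 * b : ℕ) : ℤ) = m + 2 + 2 * b := by push_cast; ring
    have e2 : m + 2 + ((2 * b + 1 : ℕ) : ℤ) = m + 2 + 2 * b + 1 := by push_cast; ring
    have e3 : m + 1 + ((2 * b + 1 : ℕ) : ℤ) = m + 2 + 2 * b := by push_cast; ring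
    have e4 : m + 2 * (b:ℤ) + 2 = m + 2 + 2 * b := by ring
    have e5 : m + 2 * (b:ℤ) + 3 = m + 2 + 2 * b + 1 := by ring
    rw [e1, e2, e3, e4, e5]
    simp only [tt, Finset.sum_add_distrib, Finset.sum_neg_distrib, Finset.sum_const,
      Finset.card_range, nsmul_eq_mul]
    push_cast
    ring

theorem stmt15 (n : ℤ) (hn : 4 < n) (hne : Even n) (A : ℤ → ℝ × ℝ)
    (O : ℝ × ℝ) (R : ℝ) (θ : ℤ → ℝ) (hR : 0 < R)
    (hmono : ∀ i, 1 ≤ i → i < n → θ i < θ (i + 1))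
    (hwrap : θ n < θ 1 + 2 * Real.pi)
    (hA : ∀ i, 1 ≤ i → i ≤ n → A i = (O.1 + R * Real.cos (θ i), O.2 + R * Real.sin (θ i)))
    (m : ℤ) (hm1 : 3 < m) (hm2 : m ≤ n - 1) (hmo : Odd m) :
    deltaProd A n m =
      (S4 (A 1) (A 2) (A (m-1)) * S4 (A 1) (A 2) (A (m+1)) * R^2 / sqDist (A 1) (A 2)) *
      (∏ l ∈ (Finset.Icc 2 (m-2)).filter (fun l => Even l),
        (S4 (A 1) (A l) (A (l+1)) * R)) *
      (∏ l ∈ (Finset.Icc (m+2) (n-1)).filter (fun l => Odd l),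
        (S4 (A 1) (A l) (A (l+1)) * R)) *
      (∏ l ∈ (Finset.Icc (m+2) (n-1)).filter (fun l => Odd l),
        (S4 (A (m-1)) (A l) (A (l+1)) * S4 (A (m-3)) (A l) (A (l+1)) * R^2 /
          sqDist (A l) (A (l+1)))) *
      (∏ k ∈ (Finset.Icc 3 (m-4)).filter (fun k => Odd k),
        ((S4 (A k) (A (k+1)) (A (m-1)) * S4 (A k) (A (k+1)) (A (m+1)) * R^2 /
            sqDist (A k) (A (k+1))) *
         (∏ l ∈ (Finset.Icc (k+1) (m-2)).filter (fun l => Even l),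
           (S4 (A k) (A l) (A (l+1)) * R / sqDist (A l) (A (l+1)))) *
         (∏ l ∈ (Finset.Icc (m+2) (n-1)).filter (fun l => Odd l),
           (1 / sqDist (A l) (A (l+1)))))) *
      (∏ k ∈ (Finset.Icc 2 (m-5)).filter (fun k => Even k),
        ∏ l ∈ (Finset.Icc (k+2) (m-2)).filter (fun l => Even l),
          (S4 (A k) (A l) (A (l+1)) * R)) *
      (∏ k ∈ Finset.Icc 2 (m-4),
        ∏ l ∈ (Finset.Icc (m+2) (n-1)).filter (fun l => Odd l),
          (S4 (A k) (A l) (A (l+1)) * R)) *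
      (S4 (A (m-2)) (A (m-1)) (A (m+1)) * R) *
      (∏ l ∈ (Finset.Icc (m+2) (n-1)).filter (fun l => Odd l),
        (S4 (A (m-2)) (A l) (A (l+1)) * R / sqDist (A l) (A (l+1)))) *
      (∏ k ∈ (Finset.Icc m (n-3)).filter (fun k => Odd k),
        (S4 (A (k+1)) (A (k+2)) (A (k+3)) * R)) *
      (∏ k ∈ Finset.Icc m (n-3),
        ∏ l ∈ (Finset.Icc (k+3) (n-1)).filter (fun l => Odd l),
          (S4 (A (k+1)) (A l) (A (l+1)) * R)) *
      (∏ k ∈ (Finset.Icc m (n-3)).filter (fun k => Odd k),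
        ∏ l ∈ (Finset.Icc (k+3) (n-1)).filter (fun l => Odd l),
          (1 / sqDist (A l) (A (l+1)))) := by
  obtain ⟨a, ha⟩ : ∃ a : ℕ, m = 2 * a + 5 := by
    rw [Int.odd_iff] at hmo
    exact ⟨((m - 5) / 2).toNat, by omega⟩
  obtain ⟨b, hb⟩ : ∃ b : ℕ, n = m + 1 + 2 * b := by
    rw [Int.odd_iff] at hmo
    rw [Int.even_iff] at hne
    exact ⟨((n - m - 1) / 2).toNat, by omega⟩
  have hmo' := hmo
  rw [Int.odd_iff] at hmo'
  have hpos : ∀ i j, 1 ≤ i → i < j → j ≤ n → 0 < 2 * R * Real.sin ((θ j - θ i) / 2) := by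
    intro i j hi hij hj
    have h1 := h_theta' n θ hmono i j hi hij hj
    have h2 : θ 1 ≤ θ i := by
      rcases eq_or_lt_of_le hi with h | h
      · rw [h]
      · exact (h_theta' n θ hmono 1 i le_rfl h (by omega)).le
    have h3 : θ j ≤ θ n := by
      rcases eq_or_lt_of_le hj with h | h
      · rw [h]
      · exact (h_theta' n θ hmono j n (by omega) h le_rfl).le
    have := Real.sin_pos_of_pos_of_lt_pi (x := (θ j - θ i) / 2) (by linarith) (by linarith)
    positivity
  obtain ⟨f, hf⟩ : ∃ f : ℤ → ℤ → ℝ, ∀ i j, 1 ≤ i → i < j → j ≤ n →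
      2 * R * Real.sin ((θ j - θ i) / 2) = Real.exp (f i j) :=
    ⟨fun i j => Real.log (2 * R * Real.sin ((θ j - θ i) / 2)), fun i j h1 h2 h3 =>
      (Real.exp_log (hpos i j h1 h2 h3)).symm⟩
  have hX : ∀ i j, 1 ≤ i → i < j → j ≤ n → sqDist (A i) (A j) = Real.exp (2 * f i j) := by
    intro i j h1 h2 h3
    rw [hA i h1 (by omega), hA j (by omega) h3, h_sq, hf i j h1 h2 h3, ← Real.exp_nat_mul]
    norm_num
  have hP : ∀ i j, 1 ≤ i → i < j → j ≤ n → pdist (A i) (A j) = Real.exp (f i j) := by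
    intro i j h1 h2 h3
    rw [pdist, hA i h1 (by omega), hA j (by omega) h3, h_sq, hf i j h1 h2 h3,
      Real.sqrt_sq (Real.exp_pos _).le]
  have hS : ∀ i j k, 1 ≤ i → i < j → j < k → k ≤ n →
      S4 (A i) (A j) (A k) * R = Real.exp (tt f i j k) := by
    intro i j k h1 h2 h3 h4
    rw [hA i h1 (by omega), hA j (by omega) (by omega), hA k (by omega) h4, h_S,
      hf i j h1 h2 (by omega), hf j k (by omega) h3 h4, hf i k h1 (by omega) h4, tt,
      Real.exp_add, Real.exp_add]
  have hSX : ∀ i j k, 1 ≤ i → i < j → j < k → k ≤ n →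
      S4 (A i) (A j) (A k) * R / sqDist (A j) (A k) = Real.exp (tt f i j k - 2 * f j k) := by
    intro i j k h1 h2 h3 h4
    rw [hS i j k h1 h2 h3 h4, hX j k (by omega) h3 h4, Real.exp_sub]
  have hX1 : ∀ i j, 1 ≤ i → i < j → j ≤ n → 1 / sqDist (A i) (A j) = Real.exp (-(2 * f i j)) := by
    intro i j h1 h2 h3
    rw [hX i j h1 h2 h3, Real.exp_neg, one_div]
  have hSS : ∀ i j k l, 1 ≤ i → i < j → j < k → k ≤ n → j < l → l ≤ n →
      S4 (A i) (A j) (A k) * S4 (A i) (A j) (A l) * R ^ 2 / sqDist (A i) (A j)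
        = Real.exp (tt f i j k + tt f i j l - 2 * f i j) := by
    intro i j k l h1 h2 h3 h4 h5 h6
    rw [Real.exp_sub, Real.exp_add, ← hS i j k h1 h2 h3 h4, ← hS i j l h1 h2 h5 h6,
      ← hX i j h1 h2 (by omega)]
    ring
  have hSS' : ∀ i i' j k, 1 ≤ i → i < j → 1 ≤ i' → i' < j → j < k → k ≤ n →
      S4 (A i) (A j) (A k) * S4 (A i') (A j) (A k) * R ^ 2 / sqDist (A j) (A k)
        = Real.exp (tt f i j k + tt f i' j k - 2 * f j k) := by
    intro i i' j k h1 h2 h3 h4 h5 h6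
    rw [Real.exp_sub, Real.exp_add, ← hS i j k h1 h2 h5 h6, ← hS i' j k h3 h4 h5 h6,
      ← hX j k (by omega) h5 h6]
    ring
  have hL : ∀ g : ℤ → ℝ, ∏ l ∈ (Finset.Icc (m+2) (n-1)).filter (fun l => Odd l), g l
      = ∏ i ∈ range b, g (m + 2 + 2 * i) := by
    intro g
    apply h_odd
    · rw [Int.odd_iff]; omega
    all_goals omega
  have hD : deltaProd A n m = Real.exp (∑ t ∈ range (2 * a + 4), ∑ i ∈ range t, f (1 + i) (1 + t)
      + ∑ t ∈ range (2 * b + 1), (∑ i ∈ range (2 * a + 4), f (1 + i) (m + 1 + t)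
        + ∑ i ∈ range t, f (m + 1 + i) (m + 1 + t))) := by
    rw [deltaProd, h_delta (fun i j => pdist (A i) (A j)), h_ne _ _ _ _ (by omega) (by omega),
      h_icc _ 1 (m-1) (2 * a + 4) (by push_cast; omega),
      h_icc _ (m+1) n (2 * b + 1) (by push_cast; omega), Real.exp_add]
    congr 1
    · apply h_exp
      intro t ht
      rw [h_ne' _ _ _ _ (by omega), h_icc _ _ _ t (by omega)]
      apply h_exp
      intro i hi
      exact hP _ _ (by omega) (by omega) (by omega)
    · apply h_exp
      intro t ht
      rw [h_ne _ _ _ _ (by omega) (by omega), h_icc _ 1 (m-1) (2 * a + 4) (by push_cast; omega),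
        h_icc _ (m+1) _ t (by omega), Real.exp_add]
      congr 1
      · apply h_exp
        intro i hi
        exact hP _ _ (by omega) (by omega) (by omega)
      · apply h_exp
        intro i hi
        exact hP _ _ (by omega) (by omega) (by omega)
  have h1 := hSS 1 2 (m-1) (m+1) (by omega) (by omega) (by omega) (by omega) (by omega) (by omega)
  have h2 : (∏ l ∈ (Finset.Icc 2 (m-2)).filter (fun l => Even l),
        (S4 (A 1) (A l) (A (l+1)) * R)) =
      Real.exp (∑ i ∈ range (a + 1), tt f 1 (2 + 2 * i) (2 + 2 * i + 1)) := by
    rw [h_even _ 2 (m-2) 2 (a+1) (by decide) (by omega) (by omega) (by push_cast; omega)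
      (by push_cast; omega)]
    apply h_exp
    intro i hi
    exact hS _ _ _ (by omega) (by omega) (by omega) (by omega)
  have h3 : ∏ l ∈ (Finset.Icc (m+2) (n-1)).filter (fun l => Odd l),
        (S4 (A 1) (A l) (A (l+1)) * R) =
      Real.exp (∑ i ∈ range b, tt f 1 (m + 2 + 2 * i) (m + 2 + 2 * i + 1)) := by
    rw [hL]
    apply h_exp
    intro i hi
    exact hS _ _ _ (by omega) (by omega) (by omega) (by omega)
  have h4 : ∏ l ∈ (Finset.Icc (m+2) (n-1)).filter (fun l => Odd l),
        (S4 (A (m-1)) (A l) (A (l+1)) * S4 (A (m-3)) (A l) (A (l+1)) * R^2 /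
          sqDist (A l) (A (l+1))) =
      Real.exp (∑ i ∈ range b, (tt f (m-1) (m + 2 + 2 * i) (m + 2 + 2 * i + 1)
          + tt f (m-3) (m + 2 + 2 * i) (m + 2 + 2 * i + 1)
          - 2 * f (m + 2 + 2 * i) (m + 2 + 2 * i + 1))) := by
    rw [hL]
    apply h_exp
    intro i hi
    exact hSS' _ _ _ _ (by omega) (by omega) (by omega) (by omega) (by omega) (by omega)
  have h5 : (∏ k ∈ (Finset.Icc 3 (m-4)).filter (fun k => Odd k),
        ((S4 (A k) (A (k+1)) (A (m-1)) * S4 (A k) (A (k+1)) (A (m+1)) * R^2 /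
            sqDist (A k) (A (k+1))) *
         (∏ l ∈ (Finset.Icc (k+1) (m-2)).filter (fun l => Even l),
           (S4 (A k) (A l) (A (l+1)) * R / sqDist (A l) (A (l+1)))) *
         (∏ l ∈ (Finset.Icc (m+2) (n-1)).filter (fun l => Odd l),
           (1 / sqDist (A l) (A (l+1)))))) =
      Real.exp (∑ i ∈ range a, (((tt f (3 + 2 * i) (3 + 2 * i + 1) (m - 1)
          + tt f (3 + 2 * i) (3 + 2 * i + 1) (m + 1) - 2 * f (3 + 2 * i) (3 + 2 * i + 1))
          + ∑ j ∈ range (a - i),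
          (tt f (3 + 2 * i) (4 + 2 * (i + j : ℕ)) (4 + 2 * (i + j : ℕ) + 1)
            - 2 * f (4 + 2 * (i + j : ℕ)) (4 + 2 * (i + j : ℕ) + 1)))
          + ∑ i ∈ range b, (- (2 * f (m + 2 + 2 * i) (m + 2 + 2 * i + 1))))) := by
    rw [h_odd _ 3 (m-4) 3 a (by decide) (by omega) (by omega) (by omega) (by omega)]
    apply h_exp
    intro i hi
    rw [Real.exp_add, Real.exp_add]
    congr 1
    · congr 1
      · exact hSS _ _ _ _ (by omega) (by omega) (by omega) (by omega) (by omega) (by omega)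
      · rw [h_even _ _ (m-2) (4 + 2 * i) (a-i) (by rw [Int.even_iff]; omega)
          (by omega) (by omega) (by omega) (by omega)]
        apply h_exp
        intro j hj
        rw [show (4 + 2 * (i:ℤ)) + 2 * j = 4 + 2 * (i + j : ℕ) by push_cast; ring]
        exact hSX _ _ _ (by omega) (by omega) (by omega) (by omega)
    · rw [hL]
      apply h_exp
      intro j hj
      exact hX1 _ _ (by omega) (by omega) (by omega)
  have h6 : (∏ k ∈ (Finset.Icc 2 (m-5)).filter (fun k => Even k),
        ∏ l ∈ (Finset.Icc (k+2) (m-2)).filter (fun l => Even l),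
          (S4 (A k) (A l) (A (l+1)) * R)) =
      Real.exp (∑ i ∈ range a, ∑ j ∈ range (a - i),
          tt f (2 + 2 * i) (4 + 2 * (i + j : ℕ)) (4 + 2 * (i + j : ℕ) + 1)) := by
    rw [h_even _ 2 (m-5) 2 a (by decide) (by omega) (by omega) (by omega) (by omega)]
    apply h_exp
    intro i hi
    rw [h_even _ _ (m-2) (4 + 2 * i) (a-i) (by rw [Int.even_iff]; omega)
          (by omega) (by omega) (by omega) (by omega)]
    apply h_exp
    intro j hj
    rw [show (4 + 2 * (i:ℤ)) + 2 * j = 4 + 2 * (i + j : ℕ) by push_cast; ring]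
    exact hS _ _ _ (by omega) (by omega) (by omega) (by omega)
  have h7 : (∏ k ∈ Finset.Icc 2 (m-4),
        ∏ l ∈ (Finset.Icc (m+2) (n-1)).filter (fun l => Odd l),
          (S4 (A k) (A l) (A (l+1)) * R)) =
      Real.exp (∑ k ∈ range (2 * a), ∑ i ∈ range b,
        tt f (2 + k) (m + 2 + 2 * i) (m + 2 + 2 * i + 1)) := by
    rw [h_icc _ 2 (m-4) (2 * a) (by push_cast; omega)]
    apply h_exp
    intro k hk
    rw [hL]
    apply h_exp
    intro i hi
    exact hS _ _ _ (by omega) (by omega) (by omega) (by omega)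
  have h8 := hS (m-2) (m-1) (m+1) (by omega) (by omega) (by omega) (by omega)
  have h9 : ∏ l ∈ (Finset.Icc (m+2) (n-1)).filter (fun l => Odd l),
        (S4 (A (m-2)) (A l) (A (l+1)) * R / sqDist (A l) (A (l+1))) =
      Real.exp (∑ i ∈ range b, (tt f (m-2) (m + 2 + 2 * i) (m + 2 + 2 * i + 1)
          - 2 * f (m + 2 + 2 * i) (m + 2 + 2 * i + 1))) := by
    rw [hL]
    apply h_exp
    intro i hi
    exact hSX _ _ _ (by omega) (by omega) (by omega) (by omega)
  have h10 : (∏ k ∈ (Finset.Icc m (n-3)).filter (fun k => Odd k),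
        (S4 (A (k+1)) (A (k+2)) (A (k+3)) * R)) =
      Real.exp (∑ i ∈ range b, tt f (m + 2 * i + 1) (m + 2 * i + 2) (m + 2 * i + 3)) := by
    rw [h_odd _ m (n-3) m b hmo (by omega) (by omega) (by omega) (by omega)]
    apply h_exp
    intro i hi
    exact hS _ _ _ (by omega) (by omega) (by omega) (by omega)
  have h11 : (∏ k ∈ Finset.Icc m (n-3),
        ∏ l ∈ (Finset.Icc (k+3) (n-1)).filter (fun l => Odd l),
          (S4 (A (k+1)) (A l) (A (l+1)) * R)) =
      Real.exp (∑ i ∈ range b, ∑ j ∈ range (b - 1 - i),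
          tt f (m + 2 * i + 1) (m + 2 + 2 * (i + j + 1 : ℕ)) (m + 2 + 2 * (i + j + 1 : ℕ) + 1)
        + ∑ i ∈ range b, ∑ j ∈ range (b - 1 - i),
          tt f (m + 1 + 2 * i + 1) (m + 2 + 2 * (i + j + 1 : ℕ))
            (m + 2 + 2 * (i + j + 1 : ℕ) + 1)) := by
    rw [← Finset.prod_filter_mul_prod_filter_not _ (fun k : ℤ => Odd k), Real.exp_add]
    simp only [Int.not_odd_iff_even]
    congr 1
    · rw [h_odd _ m (n-3) m b hmo (by omega) (by omega) (by omega) (by omega)]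
      apply h_exp
      intro i hi
      rw [h_odd _ _ (n-1) (m + 4 + 2 * i) (b-1-i) (by rw [Int.odd_iff]; omega)
          (by omega) (by omega) (by omega) (by omega)]
      apply h_exp
      intro j hj
      rw [show (m + 4 + 2 * (i:ℤ)) + 2 * j = m + 2 + 2 * (i + j + 1 : ℕ) by push_cast; ring]
      exact hS _ _ _ (by omega) (by omega) (by omega) (by omega)
    · have e : ∀ g : ℕ → ℕ → ℝ, ∑ i ∈ range b, ∑ j ∈ range (b - 1 - i), g i j
          = ∑ i ∈ range (b - 1), ∑ j ∈ range (b - 1 - i), g i j := by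
        intro g
        rcases b with _ | b
        · simp
        · rw [Finset.sum_range_succ]; simp
      rw [e, h_even _ m (n-3) (m+1) (b-1) (by rw [Int.even_iff]; omega) (by omega) (by omega)
        (by omega) (by omega)]
      apply h_exp
      intro i hi
      rw [h_odd _ _ (n-1) (m + 4 + 2 * i) (b-1-i) (by rw [Int.odd_iff]; omega)
          (by omega) (by omega) (by omega) (by omega)]
      apply h_exp
      intro j hj
      rw [show (m + 4 + 2 * (i:ℤ)) + 2 * j = m + 2 + 2 * (i + j + 1 : ℕ) by push_cast; ring]
      exact hS _ _ _ (by omega) (by omega) (by omega) (by omega)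
  have h12 : (∏ k ∈ (Finset.Icc m (n-3)).filter (fun k => Odd k),
        ∏ l ∈ (Finset.Icc (k+3) (n-1)).filter (fun l => Odd l),
          (1 / sqDist (A l) (A (l+1)))) =
      Real.exp (∑ i ∈ range b, ∑ j ∈ range (b - 1 - i),
          (- (2 * f (m + 2 + 2 * (i + j + 1 : ℕ)) (m + 2 + 2 * (i + j + 1 : ℕ) + 1)))) := by
    rw [h_odd _ m (n-3) m b hmo (by omega) (by omega) (by omega) (by omega)]
    apply h_exp
    intro i hi
    rw [h_odd _ _ (n-1) (m + 4 + 2 * i) (b-1-i) (by rw [Int.odd_iff]; omega)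
          (by omega) (by omega) (by omega) (by omega)]
    apply h_exp
    intro j hj
    rw [show (m + 4 + 2 * (i:ℤ)) + 2 * j = m + 2 + 2 * (i + j + 1 : ℕ) by push_cast; ring]
    exact hX1 _ _ (by omega) (by omega) (by omega)
  rw [hD, h1, h2, h3, h4, h5, h6, h7, h8, h9, h10, h11, h12]
  simp only [← Real.exp_add]
  congr 1
  have c1 := core1 f a m ha
  have c2 := core2 f a b m ha
  rw [Finset.sum_range_succ' _ (2 * b)]
  have e : ∀ t : ℕ, m + 1 + ((t + 1 : ℕ) : ℤ) = m + 2 + t := by intro t; push_cast; ring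
  simp only [e, Nat.cast_zero, add_zero, Finset.range_zero, Finset.sum_empty]
  rw [Finset.sum_add_distrib (s := range a) (g := fun _ => ∑ i ∈ range b, _)]
  linarith
end

section
/- Let n ≥ 4 be an even integer and let A_1, …, A_n be points in ℝ² lying on a circle in anticlockwise order. For 1 ≤ r ≤ n let c_r := 1 / ∏_{s=1, s≠r}^{n} δ_{rs}, the reciprocal of the product of the lengths of all chords emanating from A_r. Then the alternating sum vanishes: Σ_{r=1}^{n} (−1)^{r+1} c_r = 0, i.e. c_1 − c_2 + c_3 − … − c_n = 0. -/
open Finset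

/-- The points `A lo, A (lo+1), …, A hi` lie on a circle in anticlockwise order. -/
def AnticlockwiseN (A : ℕ → ℝ × ℝ) (lo hi : ℕ) : Prop :=
  ∃ (O : ℝ × ℝ) (R : ℝ) (θ : ℕ → ℝ), 0 < R ∧
    (∀ i, lo ≤ i → i < hi → θ i < θ (i + 1)) ∧
    θ hi < θ lo + 2 * Real.pi ∧
    ∀ i, lo ≤ i → i ≤ hi → A i = (O.1 + R * Real.cos (θ i), O.2 + R * Real.sin (θ i))

lemma aux_lagrange (n m : ℕ) (hm : m + 1 < n) (z : ℕ → ℂ)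
    (hz : Set.InjOn z (Finset.Icc 1 n : Finset ℕ)) :
    ∑ r ∈ Finset.Icc 1 n, z r ^ m / ∏ s ∈ (Finset.Icc 1 n).erase r, (z r - z s) = 0 := by
  have h := Lagrange.coeff_eq_sum (P := (Polynomial.X ^ m : Polynomial ℂ)) hz
    (by simp; omega)
  rw [Polynomial.coeff_X_pow, if_neg (by simp; omega)] at h
  simpa using h.symm

lemma aux_pdist (O : ℝ × ℝ) (R a b : ℝ) (hR : 0 < R) :
    pdist (O.1 + R * Real.cos a, O.2 + R * Real.sin a)
      (O.1 + R * Real.cos b, O.2 + R * Real.sin b) = 2 * R * |Real.sin ((b - a) / 2)| := by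
  have h1 : sqDist (O.1 + R * Real.cos a, O.2 + R * Real.sin a)
      (O.1 + R * Real.cos b, O.2 + R * Real.sin b) = (2 * R * Real.sin ((b - a) / 2)) ^ 2 := by
    have h2 : Real.cos (b - a) = 1 - 2 * Real.sin ((b - a) / 2) ^ 2 := by
      have h3 := Real.cos_two_mul ((b - a) / 2)
      have h4 := Real.sin_sq_add_cos_sq ((b - a) / 2)
      rw [show 2 * ((b - a) / 2) = b - a by ring] at h3
      linarith
    rw [Real.cos_sub] at h2
    have ha := Real.sin_sq_add_cos_sq a
    have hb := Real.sin_sq_add_cos_sq b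
    simp only [sqDist]
    linear_combination R ^ 2 * (ha + hb - 2 * h2)
  rw [pdist, h1, Real.sqrt_sq_eq_abs, abs_mul, abs_of_pos (by positivity : 0 < 2 * R)]

lemma aux_sin (a b : ℝ) : ((Real.sin ((b - a) / 2) : ℝ) : ℂ) =
    (Complex.exp (a * Complex.I) - Complex.exp (b * Complex.I)) * (Complex.I / 2) /
      (Complex.exp (a / 2 * Complex.I) * Complex.exp (b / 2 * Complex.I)) := by
  rw [eq_div_iff (mul_ne_zero (Complex.exp_ne_zero _) (Complex.exp_ne_zero _))]
  push_cast
  rw [Complex.sin, ← Complex.exp_add]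
  have e1 : Complex.exp (a * Complex.I) = Complex.exp (-(((b:ℂ) - a) / 2) * Complex.I) *
      Complex.exp (a / 2 * Complex.I + b / 2 * Complex.I) := by
    rw [← Complex.exp_add]; congr 1; ring
  have e2 : Complex.exp (b * Complex.I) = Complex.exp ((((b:ℂ) - a) / 2) * Complex.I) *
      Complex.exp (a / 2 * Complex.I + b / 2 * Complex.I) := by
    rw [← Complex.exp_add]; congr 1; ring
  rw [e1, e2]; ring

lemma aux_sum (n : ℕ) (hn : 4 ≤ n) (hne : Even n) (θ : ℕ → ℝ)
    (hs : ∀ r ∈ Finset.Icc 1 n, ∀ s ∈ Finset.Icc 1 n, r ≠ s → Real.sin ((θ s - θ r) / 2) ≠ 0) :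
    ∑ r ∈ Finset.Icc 1 n,
      1 / ∏ s ∈ (Finset.Icc 1 n).erase r, Real.sin ((θ s - θ r) / 2) = 0 := by
  obtain ⟨k, hk⟩ := hne
  set z : ℕ → ℂ := fun r => Complex.exp (θ r * Complex.I) with hz
  set w : ℕ → ℂ := fun r => Complex.exp (θ r / 2 * Complex.I) with hw
  have hw0 : ∀ r, w r ≠ 0 := fun r => Complex.exp_ne_zero _
  have hwz : ∀ r, w r ^ 2 = z r := by
    intro r; simp only [hz, hw]; rw [← Complex.exp_nat_mul]; congr 1; push_cast; ring
  have hsin : ∀ r s, ((Real.sin ((θ s - θ r) / 2) : ℝ) : ℂ) =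
      (z r - z s) * (Complex.I / 2) / (w r * w s) := fun r s => aux_sin _ _
  have hinj : Set.InjOn z (Finset.Icc 1 n : Finset ℕ) := by
    intro r hr s hs' h
    by_contra hrs
    apply hs r hr s hs' hrs
    have := hsin r s
    rw [h, sub_self, zero_mul, zero_div] at this
    exact Complex.ofReal_eq_zero.1 this
  have hL := aux_lagrange n (k - 1) (by omega) z hinj
  have key : ∀ r ∈ Finset.Icc 1 n,
      (((1 / ∏ s ∈ (Finset.Icc 1 n).erase r, Real.sin ((θ s - θ r) / 2) : ℝ)) : ℂ) =
      ((∏ s ∈ Finset.Icc 1 n, w s) / (Complex.I / 2) ^ (n - 1)) *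
        (z r ^ (k - 1) / ∏ s ∈ (Finset.Icc 1 n).erase r, (z r - z s)) := by
    intro r hr
    have hc : ((Finset.Icc 1 n).erase r).card = n - 1 := by
      rw [Finset.card_erase_of_mem hr]; simp
    rw [Complex.ofReal_div, Complex.ofReal_prod, Finset.prod_congr rfl (fun s _ => hsin r s),
      Finset.prod_div_distrib, Finset.prod_mul_distrib, Finset.prod_mul_distrib,
      Finset.prod_const, Finset.prod_const, hc, ← Finset.mul_prod_erase _ _ hr, ← hwz r]
    have : w r ^ (n - 1) = w r * (w r ^ 2) ^ (k - 1) := by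
      rw [← pow_mul, ← pow_succ']; congr 1; omega
    rw [this]
    simp only [Complex.ofReal_one, one_div, inv_div]
    rw [div_mul_div_comm]
    congr 1 <;> ring
  have : ((∑ r ∈ Finset.Icc 1 n,
      1 / ∏ s ∈ (Finset.Icc 1 n).erase r, Real.sin ((θ s - θ r) / 2) : ℝ) : ℂ) = 0 := by
    rw [Complex.ofReal_sum, Finset.sum_congr rfl key, ← Finset.mul_sum, hL, mul_zero]
  exact_mod_cast this

theorem stmt17 (n : ℕ) (hn : 4 ≤ n) (hne : Even n) (A : ℕ → ℝ × ℝ)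
    (hcirc : AnticlockwiseN A 1 n) :
    ∑ r ∈ Finset.Icc 1 n, (-1 : ℝ) ^ (r + 1) *
      (1 / ∏ s ∈ (Finset.Icc 1 n).filter (fun s => s ≠ r), pdist (A r) (A s)) = 0 := by
  obtain ⟨O, R, θ, hR, hθ, hlast, hA⟩ := hcirc
  have hmono : ∀ r s, 1 ≤ r → r < s → s ≤ n → θ r < θ s := by
    intro r s hr hrs
    induction s, hrs using Nat.le_induction with
    | base => intro h; exact hθ r hr (by omega)
    | succ s hs ih => intro h; exact (ih (by omega)).trans (hθ s (by omega) (by omega))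
  have hmono' : ∀ r s, 1 ≤ r → r ≤ s → s ≤ n → θ r ≤ θ s := by
    intro r s hr hrs hs
    rcases hrs.eq_or_lt with h | h
    · rw [h]
    · exact (hmono r s hr h hs).le
  have hpos : ∀ r s, 1 ≤ r → r < s → s ≤ n → 0 < Real.sin ((θ s - θ r) / 2) := by
    intro r s hr hrs hs
    have h1 := hmono r s hr hrs hs
    have h2 := hmono' 1 r le_rfl hr (by omega)
    have h3 := hmono' s n (by omega) hs le_rfl
    exact Real.sin_pos_of_pos_of_lt_pi (by linarith) (by linarith)
  have hneg : ∀ r s, 1 ≤ s → s < r → r ≤ n → Real.sin ((θ s - θ r) / 2) < 0 := by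
    intro r s hr hrs hs
    have := hpos s r hr hrs hs
    rw [show (θ s - θ r) / 2 = -((θ r - θ s) / 2) by ring, Real.sin_neg]
    linarith
  have hS := aux_sum n hn hne θ (by
    intro r hr s hs hrs
    simp only [Finset.mem_Icc] at hr hs
    rcases lt_or_gt_of_ne hrs with h | h
    · exact (hpos r s hr.1 h hs.2).ne'
    · exact (hneg r s hs.1 h hr.2).ne)
  have key : ∀ r ∈ Finset.Icc 1 n, (-1 : ℝ) ^ (r + 1) *
      (1 / ∏ s ∈ (Finset.Icc 1 n).filter (fun s => s ≠ r), pdist (A r) (A s)) =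
      (1 / (2 * R) ^ (n - 1)) *
        (1 / ∏ s ∈ (Finset.Icc 1 n).erase r, Real.sin ((θ s - θ r) / 2)) := by
    intro r hr
    have hc : ((Finset.Icc 1 n).erase r).card = n - 1 := by
      rw [Finset.card_erase_of_mem hr]; simp
    have hr' := Finset.mem_Icc.1 hr
    rw [Finset.filter_ne']
    have hp : ∏ s ∈ (Finset.Icc 1 n).erase r, pdist (A r) (A s) =
        ∏ s ∈ (Finset.Icc 1 n).erase r,
          ((2 * R) * ((if s < r then (-1 : ℝ) else 1) * Real.sin ((θ s - θ r) / 2))) := by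
      apply Finset.prod_congr rfl
      intro s hs
      simp only [Finset.mem_erase, Finset.mem_Icc] at hs
      rw [hA r hr'.1 hr'.2, hA s hs.2.1 hs.2.2, aux_pdist _ _ _ _ hR]
      congr 1
      split_ifs with h
      · rw [abs_of_neg (hneg r s hs.2.1 h hr'.2)]; ring
      · rw [abs_of_pos (hpos r s hr'.1 (by omega) hs.2.2)]; ring
    have hsgn : ∏ s ∈ (Finset.Icc 1 n).erase r, (if s < r then (-1 : ℝ) else 1)
        = (-1) ^ (r + 1) := by
      rw [← Finset.prod_filter]
      have : ((Finset.Icc 1 n).erase r).filter (fun s => s < r) = Finset.Ico 1 r := by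
        ext s; simp only [Finset.mem_filter, Finset.mem_erase, Finset.mem_Icc, Finset.mem_Ico]
        omega
      rw [this, Finset.prod_const, Nat.card_Ico]
      rw [show r + 1 = (r - 1) + 2 by omega, pow_add]; simp
    rw [hp, Finset.prod_mul_distrib, Finset.prod_const, Finset.prod_mul_distrib, hc, hsgn]
    have h1 : ((-1 : ℝ) ^ (r + 1)) * (-1) ^ (r + 1) = 1 := by
      rw [← mul_pow]; simp
    have h0 : ((-1 : ℝ) ^ (r + 1)) ≠ 0 := by simp
    have h2 : ((-1 : ℝ) ^ (r + 1))⁻¹ = (-1 : ℝ) ^ (r + 1) := (by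
      exact (eq_inv_of_mul_eq_one_left h1).symm)
    rw [one_div, one_div, one_div, mul_inv ((2 * R) ^ (n - 1)), mul_inv ((-1 : ℝ) ^ (r + 1)), h2]
    linear_combination (((2 * R) ^ (n - 1))⁻¹ *
      (∏ s ∈ (Finset.Icc 1 n).erase r, Real.sin ((θ s - θ r) / 2))⁻¹) * h1
  rw [Finset.sum_congr rfl key, ← Finset.mul_sum, hS, mul_zero]
end
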